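/- arXiv:0704.3693 — 3 statements merged into one kernel-verified Lean document; each statement's English description precedes it below -/
import Mathlib

section
/- (Riemenschneider duality.) Assume n ≥ 2. Then the list Λ = (2 repeated e₁ times, σ₂−σ₁+2, 2 repeated e₂ times, σ₃−σ₂+2, …, σ_z−σ_{z−1}+2, 2 repeated e_z times) consists of integers ≥ 2, and its Hirzebruch–Jung continued fraction value equals r/(r−a); that is, Λ is the Hirzebruch–Jung continued fraction expansion of r/(r−a). -/
/-- Hirzebruch–Jung (negative) continued fraction value of a list:
`hj [α₁, …, αₙ] = α₁ − 1/(α₂ − 1/(⋯ − 1/αₙ))`. -/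
def hj : List ℚ → ℚ
  | [] => 0
  | q :: L => q - 1 / hj L

/-- The list `Λ = (2,…,2 (e₁ times), σ₂−σ₁+2, 2,…,2 (e₂ times), …, σ_z−σ_{z−1}+2,
2,…,2 (e_z times))`, where `e₁ = α₁ − 2`, `e_z = αₙ − 2` and `e_s = α_{σ_s} − 3`
for `1 < s < z`. -/
def dualList (n z : ℕ) (α : ℕ → ℕ) (σ : ℕ → ℕ) : List ℚ :=
  List.replicate (α 1 - 2) (2 : ℚ) ++
    ((List.range (z - 1)).map fun s =>
      ((σ (s + 2) - σ (s + 1) + 2 : ℕ) : ℚ) ::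
        List.replicate (if s + 2 = z then α n - 2 else α (σ (s + 2)) - 3) (2 : ℚ)).flatten

/-- The value of the tail `[α (t+1), …, α n]`. -/
def hjTail (α : ℕ → ℕ) (n t : ℕ) : ℚ :=
  hj ((List.range (n - t)).map fun i => (α (t + i + 1) : ℚ))

theorem hjTail_of_lt (α : ℕ → ℕ) {n t : ℕ} (h : t < n) :
    hjTail α n t = α (t + 1) - 1 / hjTail α n (t + 1) := by
  obtain ⟨m, rfl⟩ := Nat.exists_eq_add_of_lt h
  have h₁ : t + m + 1 - t = m + 1 := by omega
  have h₂ : t + m + 1 - (t + 1) = m := by omega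
  simp only [hjTail, h₁, h₂, List.range_succ_eq_map, List.map_cons, List.map_map, hj]
  congr 4
  funext i
  simp only [Function.comp_apply]
  congr 2
  omega

theorem hjTail_self (α : ℕ → ℕ) (n : ℕ) : hjTail α n n = 0 := by
  simp [hjTail, hj]

theorem one_lt_hjTail {α : ℕ → ℕ} {n : ℕ} (hα : ∀ t, 1 ≤ t → t ≤ n → 2 ≤ α t) {t : ℕ}
    (ht : t < n) : 1 < hjTail α n t := by
  induction h : n - t generalizing t with
  | zero => omega
  | succ m ih =>
    have hαt : (2 : ℚ) ≤ α (t + 1) := by exact_mod_cast hα (t + 1) (by omega) ht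
    rw [hjTail_of_lt α ht]
    rcases Nat.lt_or_ge (t + 1) n with h' | h'
    · have hT := ih h' (by omega)
      have : 1 / hjTail α n (t + 1) < 1 := (div_lt_one (by linarith)).2 hT
      linarith
    · obtain rfl : t + 1 = n := by omega
      rw [hjTail_self]
      linarith [div_zero (1 : ℚ)]

/-- A run of twos in `α` shifts `1 / (x - 1)` by its length. -/
theorem one_div_hjTail_sub_one {α : ℕ → ℕ} {n : ℕ} (hα : ∀ t, 1 ≤ t → t ≤ n → 2 ≤ α t)
    {p j : ℕ} (hpj : p + j < n) (htwo : ∀ t, p < t → t ≤ p + j → α t = 2) :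
    1 / (hjTail α n p - 1) = j + 1 / (hjTail α n (p + j) - 1) := by
  induction j with
  | zero => simp
  | succ j ih =>
    have hT : 1 < hjTail α n (p + j + 1) := one_lt_hjTail hα hpj
    rw [ih (by omega) fun t h₁ h₂ => htwo t h₁ (by omega),
      hjTail_of_lt α (show p + j < n by omega), htwo (p + j + 1) (by omega) (by omega),
      ← add_assoc p j 1]
    have h₀ : hjTail α n (p + j + 1) ≠ 0 := by linarith
    have h₁ : hjTail α n (p + j + 1) - 1 ≠ 0 := by linarith
    have h₂ : ((2 : ℕ) : ℚ) - 1 / hjTail α n (p + j + 1) - 1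
        = (hjTail α n (p + j + 1) - 1) / hjTail α n (p + j + 1) := by
      field_simp
      push_cast
      ring
    rw [h₂]
    field_simp
    push_cast
    ring

/-- Prepending `e` twos on one side of the duality `1 / x + 1 / y = 1` adds `e` on the other. -/
theorem one_div_hj_replicate_two_append {L : List ℚ} {u : ℚ} (hu : 0 < u)
    (hL : 1 / hj L = 1 - 1 / u) (e : ℕ) :
    1 / hj (List.replicate e 2 ++ L) = 1 - 1 / (u + e) := by
  induction e with
  | zero => simpa using hL
  | succ e ih =>
    have h₁ : 0 < u + e := by positivity
    have h₂ : 2 - (1 - 1 / (u + e)) = (u + e + 1) / (u + e) := by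
      field_simp
      ring
    rw [List.replicate_succ, List.cons_append, hj, ih, h₂]
    push_cast
    field_simp
    ring

/-- Splitting off the first block of a flattened list of blocks indexed by `[k, m)`. -/
theorem flatten_map_range_sub {β : Type*} (g : ℕ → List β) {k m : ℕ} (h : k < m) :
    ((List.range (m - k)).map fun i => g (k + i)).flatten
      = g k ++ ((List.range (m - (k + 1))).map fun i => g (k + 1 + i)).flatten := by
  have h₁ : m - k = m - (k + 1) + 1 := by omega
  rw [h₁, List.range_succ_eq_map, List.map_cons, List.map_map, List.flatten_cons]
  congr 3
  funext i
  simp only [Function.comp_apply]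
  congr 1
  omega

theorem two_le_of_mem_dualList {n z : ℕ} {α σ : ℕ → ℕ} {q : ℚ} (hq : q ∈ dualList n z α σ) :
    2 ≤ q := by
  simp only [dualList, List.mem_append, List.mem_flatten, List.mem_map] at hq
  rcases hq with hq | ⟨l, ⟨s, -, rfl⟩, hq⟩
  · exact (List.eq_of_mem_replicate hq).ge
  · rcases List.mem_cons.1 hq with rfl | hq
    · push_cast
      exact le_add_of_nonneg_left (Nat.cast_nonneg _)
    · exact (List.eq_of_mem_replicate hq).ge

/-- If the value `y` of `L` is dual to `2 - 1 / w`, then prepending `c - 2` twos to `L` gives a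
value dual to `c - 1 / w`. -/
theorem one_div_hj_replicate_append_of_hj_eq {L : List ℚ} {w : ℚ} (hw : 1 < w)
    (hL : hj L = 2 + 1 / (w - 1)) (e : ℕ) :
    1 / hj (List.replicate e 2 ++ L) = 1 - 1 / (2 - 1 / w + e) := by
  have h₁ : 0 < w - 1 := by linarith
  have h₂ : 1 / w < 1 := (div_lt_one (by linarith)).2 hw
  refine one_div_hj_replicate_two_append (by linarith) ?_ e
  have h₃ : 2 * w - 1 ≠ 0 := by linarith
  have h₄ : w ≠ 0 := by linarith
  have h₅ : 2 + 1 / (w - 1) = (2 * w - 1) / (w - 1) := by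
    field_simp
    ring
  have h₆ : 2 - 1 / w = (2 * w - 1) / w := by
    field_simp
  rw [hL, h₅, h₆]
  field_simp
  ring

/-- Riemenschneider duality: the list `Λ` consists of integers `≥ 2` and is
the Hirzebruch–Jung continued fraction expansion of `r/(r−a)`. -/
theorem stmt_1 (r a n : ℕ) (α : ℕ → ℕ)
    (ha : 1 ≤ a) (har : a < r) (hcop : Nat.Coprime r a) (hn : 2 ≤ n)
    (hα : ∀ t, 1 ≤ t → t ≤ n → 2 ≤ α t)
    (hval : hj ((List.range n).map fun t => (α (t + 1) : ℚ)) = (r : ℚ) / (a : ℚ))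
    -- the σ-sequence: σ 1 = 1 < σ 2 < ⋯ < σ z = n, where σ_{s+1} is the least index
    -- t with σ_s < t ≤ n and α_t > 2 if one exists, and σ_{s+1} = n otherwise,
    -- the process stopping as soon as n is reached
    (z : ℕ) (σ : ℕ → ℕ) (hz : 2 ≤ z)
    (hσ1 : σ 1 = 1) (hσz : σ z = n)
    (hσmono : ∀ s, 1 ≤ s → s < z → σ s < σ (s + 1))
    (hσstop : ∀ s, 1 ≤ s → s < z → σ s < n)
    (hσnext : ∀ s, 1 ≤ s → s < z →
      ((∃ t, σ s < t ∧ t ≤ n ∧ 2 < α t) →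
        (σ s < σ (s + 1) ∧ σ (s + 1) ≤ n ∧ 2 < α (σ (s + 1)) ∧
          ∀ t, σ s < t → t ≤ n → 2 < α t → σ (s + 1) ≤ t)) ∧
      ((¬ ∃ t, σ s < t ∧ t ≤ n ∧ 2 < α t) → σ (s + 1) = n)) :
    (∀ q ∈ dualList n z α σ, (2 : ℚ) ≤ q) ∧
    hj (dualList n z α σ) = (r : ℚ) / ((r : ℚ) - (a : ℚ)) := by
  refine ⟨fun q => two_le_of_mem_dualList, ?_⟩
  have hrun : ∀ s, 1 ≤ s → s < z → ∀ t, σ s < t → t < σ (s + 1) → α t = 2 := by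
    intro s h₁ h₂ t h₃ h₄
    have hle : σ (s + 1) ≤ n := by
      by_cases h : s + 1 < z
      · exact (hσstop (s + 1) (by omega) h).le
      · rw [show s + 1 = z by omega, hσz]
    have h₅ := hα t (by omega) (by omega)
    by_contra h₆
    have h₇ : 2 < α t := by omega
    have := ((hσnext s h₁ h₂).1 ⟨t, h₃, by omega, h₇⟩).2.2.2 t h₃ (by omega) h₇
    omega
  have hbig : ∀ s, 1 ≤ s → s + 1 < z → 2 < α (σ (s + 1)) := by
    intro s h₁ h₂
    by_contra h
    by_cases hex : ∃ t, σ s < t ∧ t ≤ n ∧ 2 < α t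
    · exact h ((hσnext s h₁ (by omega)).1 hex).2.2.1
    · have := (hσnext s h₁ (by omega)).2 hex
      have := hσstop (s + 1) (by omega) h₂
      omega
  let g : ℕ → List ℚ := fun s => ((σ (s + 2) - σ (s + 1) + 2 : ℕ) : ℚ) ::
        List.replicate (if s + 2 = z then α n - 2 else α (σ (s + 2)) - 3) (2 : ℚ)
  have key : ∀ k, k < z - 1 → hj ((List.range (z - 1 - k)).map fun i => g (k + i)).flatten
      = 2 + 1 / (hjTail α n (σ (k + 1)) - 1) := by
    intro k hk
    induction hm : z - 1 - k generalizing k with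
    | zero => omega
    | succ m ih =>
      rw [← hm, flatten_map_range_sub g hk]
      set L := ((List.range (z - 1 - (k + 1))).map fun i => g (k + 1 + i)).flatten with hLdef
      have hlt : σ (k + 1) < σ (k + 2) := hσmono (k + 1) (by omega) (by omega)
      obtain ⟨j, hj'⟩ := Nat.exists_eq_add_of_lt hlt
      have hjn : σ (k + 1) + j < n := by
        by_cases h : k + 2 < z
        · have := hσstop (k + 2) (by omega) h
          omega
        · have : σ (k + 2) = n := by rw [show k + 2 = z by omega, hσz]
          omega
      have hd : σ (k + 2) - σ (k + 1) + 2 = j + 3 := by omega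
      have hT := one_lt_hjTail hα hjn
      rw [one_div_hjTail_sub_one hα hjn fun t h₁ h₂ =>
        hrun (k + 1) (by omega) (by omega) t h₁ (by change t < σ (k + 2); omega)]
      have htail : 1 / hj (List.replicate
          (if k + 2 = z then α n - 2 else α (σ (k + 2)) - 3) 2 ++ L)
          = 1 - 1 / (hjTail α n (σ (k + 1) + j) - 1) := by
        rw [hjTail_of_lt α hjn, ← hj']
        by_cases h : k + 2 = z
        · have hL : L = [] := by
            rw [hLdef, show z - 1 - (k + 1) = 0 by omega]
            rfl
          have h2 := hα n (by omega) le_rfl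
          rw [if_pos h, hL, one_div_hj_replicate_two_append one_pos (by simp [hj])]
          rw [show k + 1 + 1 = z from h, hσz, hjTail_self]
          push_cast [h2]
          congr 2
          ring
        · have hw := one_lt_hjTail hα (hσstop (k + 2) (by omega) (by omega))
          have h3 : 3 ≤ α (σ (k + 2)) := hbig (k + 1) (by omega) (by omega)
          rw [if_neg h, one_div_hj_replicate_append_of_hj_eq hw]
          · push_cast [h3]
            congr 2
            ring
          · have := ih (k + 1) (by omega) (by omega)
            rw [show m = z - 1 - (k + 1) by omega] at this
            exact this
      simp only [g, List.cons_append, hj]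
      rw [htail, hd]
      push_cast
      ring
  have hx : hjTail α n 0 = r / a := by
    rw [← hval]
    simp [hjTail]
  have hw : 1 < hjTail α n 1 := one_lt_hjTail hα (by omega)
  have h2 : 2 ≤ α 1 := hα 1 le_rfl (by omega)
  have hk := key 0 (by omega)
  simp only [zero_add, Nat.sub_zero, hσ1] at hk
  have hinv := one_div_hj_replicate_append_of_hj_eq hw hk (α 1 - 2)
  have hsum : 2 - 1 / hjTail α n 1 + ((α 1 - 2 : ℕ) : ℚ) = r / a := by
    rw [← hx, hjTail_of_lt α (show 0 < n by omega)]
    push_cast [h2]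
    ring
  rw [hsum] at hinv
  change 1 / hj (dualList n z α σ) = _ at hinv
  have hr : (r : ℚ) ≠ 0 := by
    have : r ≠ 0 := by omega
    exact_mod_cast this
  rw [← one_div_one_div (hj (dualList n z α σ)), hinv, one_div_div, one_sub_div hr, one_div_div]
end

section
/- For all 0 ≤ p ≤ n+1 one has i_p = j′_{n+1−p} and j_p = i′_{n+1−p}; in particular b = jₙ. -/
/-- The two-step linear recursion `s₀ = x0`, `s₁ = x1`, `s_{t+1} = α_t s_t − s_{t−1}`;
with `x0 = r, x1 = a` this is the i-series and with `x0 = 0, x1 = 1` the j-series. -/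
def ser (x0 x1 : ℤ) (α : ℕ → ℕ) : ℕ → ℤ
  | 0 => x0
  | 1 => x1
  | t + 2 => (α (t + 1) : ℤ) * ser x0 x1 α (t + 1) - ser x0 x1 α t

theorem ser_add_two (x y : ℤ) (α : ℕ → ℕ) (t : ℕ) :
    ser x y α (t + 2) = (α (t + 1) : ℤ) * ser x y α (t + 1) - ser x y α t := rfl

/-- The j-series is strictly increasing when all entries are at least `2`. -/
theorem ser_nonneg_and_lt_succ (β : ℕ → ℕ) (m : ℕ) (hβ : ∀ t, 1 ≤ t → t ≤ m → 2 ≤ β t) :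
    0 ≤ ser 0 1 β m ∧ ser 0 1 β m < ser 0 1 β (m + 1) := by
  induction m with
  | zero => simp [ser]
  | succ m ih =>
    obtain ⟨h0, h1⟩ := ih fun t h h' => hβ t h (by lia)
    have h2 : (2 : ℤ) ≤ β (m + 1) := by exact_mod_cast hβ (m + 1) (by lia) le_rfl
    rw [ser_add_two]
    exact ⟨by linarith, by nlinarith⟩

theorem ser_pos (β : ℕ → ℕ) (m : ℕ) (hβ : ∀ t, 1 ≤ t → t ≤ m → 2 ≤ β t) :
    0 < ser 0 1 β (m + 1) :=
  (ser_nonneg_and_lt_succ β m hβ).1.trans_lt (ser_nonneg_and_lt_succ β m hβ).2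

theorem isCoprime_ser_succ (β : ℕ → ℕ) (m : ℕ) :
    IsCoprime (ser 0 1 β (m + 1)) (ser 0 1 β m) := by
  induction m with
  | zero => exact isCoprime_one_left
  | succ m ih =>
    obtain ⟨u, v, h⟩ := ih
    refine ⟨-v, u + v * β (m + 1), ?_⟩
    rw [ser_add_two]
    linear_combination h

/-- The value of `[β_m, …, β₁]` is the quotient of consecutive terms of the j-series of `β`. -/
theorem hj_reverse_eq_div (β : ℕ → ℕ) (m : ℕ) (hβ : ∀ t, 1 ≤ t → t ≤ m → 2 ≤ β t) :
    hj ((List.range m).map fun t => (β (m - t) : ℚ)) =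
      (ser 0 1 β (m + 1) : ℚ) / (ser 0 1 β m : ℚ) := by
  induction m with
  | zero => simp [ser, hj]
  | succ m ih =>
    have hβ' : ∀ t, 1 ≤ t → t ≤ m → 2 ≤ β t := fun t h h' => hβ t h (by lia)
    have hpos : (ser 0 1 β (m + 1) : ℚ) ≠ 0 := by exact_mod_cast (ser_pos β m hβ').ne'
    rw [List.range_succ_eq_map, List.map_cons, List.map_map, hj]
    have htail : ((fun t => (β (m + 1 - t) : ℚ)) ∘ Nat.succ) = fun t => (β (m - t) : ℚ) := by
      funext t
      simp
    rw [htail, ih hβ', ser_add_two]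
    push_cast
    rw [one_div_div]
    field_simp

/-- Read backwards, a j-series satisfies the recursion of the reversed list. -/
theorem ser_reverse (α β : ℕ → ℕ) (n : ℕ) (h : ∀ t, 1 ≤ t → t ≤ n → β t = α (n + 1 - t))
    (p : ℕ) (hp : p ≤ n + 1) :
    ser (ser 0 1 α (n + 1)) (ser 0 1 α n) β p = ser 0 1 α (n + 1 - p) := by
  induction p using Nat.twoStepInduction with
  | zero => rfl
  | one => rfl
  | more p ih₀ ih₁ =>
    obtain ⟨k, rfl⟩ : ∃ k, n = p + 1 + k := ⟨n - (p + 1), by lia⟩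
    have e₀ : p + 1 + k + 1 - p = k + 2 := by lia
    have e₁ : p + 1 + k + 1 - (p + 1) = k + 1 := by lia
    have e₂ : p + 1 + k + 1 - (p + 2) = k := by lia
    rw [ser_add_two, ih₀ (by lia), ih₁ (by lia), h (p + 1) (by lia) (by lia), e₀, e₁, e₂,
      ser_add_two]
    ring

theorem ser_wronskian (x y : ℤ) (α : ℕ → ℕ) (p : ℕ) :
    ser x y α p * ser 0 1 α (p + 1) - ser x y α (p + 1) * ser 0 1 α p = x := by
  induction p with
  | zero => simp [ser]
  | succ p ih =>
    rw [ser_add_two, ser_add_two]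
    linear_combination ih

/-- `i_p = j′_{n+1−p}` and `j_p = i′_{n+1−p}` for all `0 ≤ p ≤ n+1`;
in particular `b = jₙ`.  Here `i′, j′` are the series built from `(r, b)` and the
reversed list `[αₙ, …, α₁]`, i.e. from `α′ t = α (n + 1 − t)`. -/
theorem stmt_2 (r a n : ℕ) (α : ℕ → ℕ)
    (ha : 1 ≤ a) (har : a < r) (hcop : Nat.Coprime r a) (hn : 1 ≤ n)
    (hα : ∀ t, 1 ≤ t → t ≤ n → 2 ≤ α t)
    (hval : hj ((List.range n).map fun t => (α (t + 1) : ℚ)) = (r : ℚ) / (a : ℚ))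
    -- b : the (unique) integer with 1 ≤ b < r whose HJ expansion of r/b is the
    -- reversed list [αₙ, …, α₁]
    (b : ℕ) (hb1 : 1 ≤ b) (hbr : b < r)
    (hvalb : hj ((List.range n).map fun t => (α (n - t) : ℚ)) = (r : ℚ) / (b : ℚ)) :
    (∀ p, p ≤ n + 1 →
      ser r a α p = ser 0 1 (fun t => α (n + 1 - t)) (n + 1 - p) ∧
      ser 0 1 α p = ser r b (fun t => α (n + 1 - t)) (n + 1 - p)) ∧
    (b : ℤ) = ser 0 1 α n := by
  set β : ℕ → ℕ := fun t => α (n + 1 - t) with hβdef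
  have hβ : ∀ t, 1 ≤ t → t ≤ n → 2 ≤ β t := fun t h h' => hα _ (by lia) (by lia)
  have hαβ : ∀ t, 1 ≤ t → t ≤ n → α t = β (n + 1 - t) := fun t h h' => by
    simp only [hβdef]
    congr 1
    lia
  have hlist : ((List.range n).map fun t => (α (t + 1) : ℚ)) =
      (List.range n).map fun t => (β (n - t) : ℚ) := by
    refine List.map_congr_left fun t ht => ?_
    rw [hαβ (t + 1) (by lia) (by simpa using ht), Nat.add_sub_add_right]
  obtain ⟨m, rfl⟩ : ∃ m, n = m + 1 := ⟨n - 1, by lia⟩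
  have hβn := ser_pos β m fun t h h' => hβ t h (by lia)
  rw [hlist, hj_reverse_eq_div β _ hβ] at hval
  rw [hj_reverse_eq_div α _ hα] at hvalb
  obtain ⟨hr, ha'⟩ : ser 0 1 β (m + 1 + 1) = r ∧ ser 0 1 β (m + 1) = a :=
    Rat.div_int_inj hβn (by exact_mod_cast ha)
      (Int.isCoprime_iff_gcd_eq_one.1 (isCoprime_ser_succ β (m + 1)))
      (by simpa using hcop) (by rw [hval, Int.cast_natCast, Int.cast_natCast])
  have hi : ∀ p, p ≤ m + 1 + 1 → ser r a α p = ser 0 1 β (m + 1 + 1 - p) := by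
    rw [← hr, ← ha']
    exact ser_reverse β α (m + 1) hαβ
  have hr' : ser 0 1 α (m + 1 + 1) = r := by
    have hw := ser_wronskian r a α (m + 1)
    rw [hi (m + 1) (by lia), hi (m + 1 + 1) le_rfl, Nat.add_sub_cancel_left, Nat.sub_self] at hw
    simpa [ser] using hw
  have hb : (b : ℤ) = ser 0 1 α (m + 1) := by
    have hr0 : (r : ℚ) ≠ 0 := by exact_mod_cast (by lia : r ≠ 0)
    rw [hr', Int.cast_natCast, div_eq_mul_inv, div_eq_mul_inv] at hvalb
    exact_mod_cast (inv_injective (mul_left_cancel₀ hr0 hvalb)).symm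
  refine ⟨fun p hp => ⟨hi p hp, ?_⟩, hb⟩
  rw [← hr', hb, ser_reverse α β (m + 1) (fun _ _ _ => rfl) _ (by lia), Nat.sub_sub_self hp]
end

section
/- For each 1 ≤ p ≤ n, the R-module S_{i_p} is generated by x^{i_p} and y^{j_p}: every f ∈ ℂ[x,y] with g(f) = ε^{i_p} f can be written f = r₁ x^{i_p} + r₂ y^{j_p} with r₁, r₂ ∈ R. -/
open MvPolynomial

lemma ser_succ (x0 x1 : ℤ) (α : ℕ → ℕ) (t : ℕ) :
    ser x0 x1 α (t + 1) = ser x1 ((α 1 : ℤ) * x1 - x0) (fun s => α (s + 1)) t := by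
  induction t using Nat.twoStepInduction with
  | zero => simp [ser]
  | one => simp [ser]
  | more t ih1 ih2 =>
    rw [show t + 2 + 1 = (t + 1) + 2 from rfl, ser, ih1, ih2, ser]

lemma one_lt_hj (n : ℕ) (α : ℕ → ℕ) (hα : ∀ t, t ≤ n → 2 ≤ α (t + 1)) :
    1 < hj ((List.range (n + 1)).map fun t => (α (t + 1) : ℚ)) := by
  induction n generalizing α with
  | zero =>
    simpa [hj, Nat.succ_le_iff] using Nat.lt_of_succ_le (hα 0 le_rfl)
  | succ n ih =>
    have h : (2 : ℚ) ≤ α 1 := by exact_mod_cast hα 0 (Nat.zero_le _)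
    have key := ih (fun s => α (s + 1)) fun t ht => hα (t + 1) (by omega)
    rw [List.range_succ_eq_map, List.map_cons, List.map_map, hj]
    have hlt := (div_lt_one (zero_lt_one.trans key)).2 key
    simp only [Function.comp_def, Nat.succ_eq_add_one, zero_add]
    linarith

lemma ser_pos_and_decreasing (n : ℕ) (x0 x1 : ℤ) (α : ℕ → ℕ) (hx : 0 < x1)
    (hα : ∀ t, 1 ≤ t → t ≤ n → 2 ≤ α t)
    (hval : hj ((List.range n).map fun t => (α (t + 1) : ℚ)) = (x0 : ℚ) / (x1 : ℚ)) :
    ∀ p, p < n → 0 < ser x0 x1 α (p + 1) ∧ ser x0 x1 α (p + 1) < ser x0 x1 α p := by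
  induction n generalizing x0 x1 α with
  | zero => intro p hp; omega
  | succ n ih =>
    have hxq : (0 : ℚ) < x1 := by exact_mod_cast hx
    rintro (_ | p) hp
    · have h1 := one_lt_hj n α fun t ht => hα _ (by omega) (by omega)
      rw [hval, one_lt_div hxq] at h1
      exact ⟨hx, by exact_mod_cast h1⟩
    · obtain ⟨m, rfl⟩ : ∃ m, n = m + 1 := ⟨n - 1, by omega⟩
      have h1 := one_lt_hj m (fun s => α (s + 1)) fun t ht => hα _ (by omega) (by omega)
      rw [List.range_succ_eq_map, List.map_cons, List.map_map, hj] at hval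
      simp only [Function.comp_def, Nat.succ_eq_add_one, zero_add] at hval
      set q := hj ((List.range (m + 1)).map fun t => (α (t + 1 + 1) : ℚ)) with hq
      have hq0 : 0 < q := zero_lt_one.trans h1
      have hy : (((α 1 : ℤ) * x1 - x0 : ℤ) : ℚ) = x1 / q := by
        push_cast
        field_simp at hval ⊢
        linarith
      have hypos : 0 < (α 1 : ℤ) * x1 - x0 := by
        have : (0 : ℚ) < (((α 1 : ℤ) * x1 - x0 : ℤ) : ℚ) := by rw [hy]; positivity
        exact_mod_cast this
      rw [ser_succ, ser_succ x0 x1 α p]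
      refine ih _ _ (fun s => α (s + 1)) hypos (fun t h1 h2 => hα _ (by omega) (by omega)) ?_ p
        (by omega)
      rw [hy, ← hq]
      field_simp

lemma ser_nonneg_and_increasing (n : ℕ) (α : ℕ → ℕ) (hα : ∀ t, 1 ≤ t → t ≤ n → 2 ≤ α t)
    (p : ℕ) (hp : p < n) : 0 ≤ ser 0 1 α p ∧ ser 0 1 α p < ser 0 1 α (p + 1) := by
  induction p with
  | zero => simp [ser]
  | succ p ih =>
    obtain ⟨h0, h1⟩ := ih (by omega)
    have h2 : (2 : ℤ) ≤ α (p + 1) := by exact_mod_cast hα (p + 1) (by omega) (by omega)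
    refine ⟨by omega, ?_⟩
    rw [show ser 0 1 α (p + 1 + 1) = (α (p + 1) : ℤ) * ser 0 1 α (p + 1) - ser 0 1 α p from rfl]
    nlinarith

lemma ser_det (x0 x1 : ℤ) (α : ℕ → ℕ) (p : ℕ) :
    ser x0 x1 α p * ser 0 1 α (p + 1) - ser x0 x1 α (p + 1) * ser 0 1 α p = x0 := by
  induction p with
  | zero => simp [ser]
  | succ p ih =>
    rw [show p + 1 + 1 = p + 2 from rfl, ser, ser]
    linear_combination ih

lemma dvd_ser_sub (x0 x1 : ℤ) (α : ℕ → ℕ) (p : ℕ) :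
    x0 ∣ ser x0 x1 α p - x1 * ser 0 1 α p := by
  induction p using Nat.twoStepInduction with
  | zero => simp [ser]
  | one => simp [ser]
  | more p ih1 ih2 =>
    obtain ⟨k, hk⟩ := ih1
    obtain ⟨l, hl⟩ := ih2
    refine ⟨(α (p + 1) : ℤ) * l - k, ?_⟩
    rw [ser, ser]
    linear_combination (α (p + 1) : ℤ) * hl - hk

/-- A point of the coset `u + a v ≡ i (mod r)` in the closed quadrant lies outside the box
`[0, i) × [0, j)`, when `(i', -j')` and `(i, -j)` form a basis of the lattice `u + a v ≡ 0`. -/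
lemma le_or_le_of_dvd {r a i i' j j' u v : ℤ} (hr : 0 < r) (hi : 0 < i) (hii : i < i')
    (hjj : j' < j) (hdet : i' * j - i * j' = r) (hd : r ∣ i - a * j)
    (hd' : r ∣ i' - a * j') (hu : 0 ≤ u) (hv : 0 ≤ v) (huv : r ∣ u + a * v - i) :
    i ≤ u ∨ j ≤ v := by
  by_contra! hcon
  obtain ⟨hui, hvj⟩ := hcon
  obtain ⟨k, hk⟩ := hd
  obtain ⟨k', hk'⟩ := hd'
  obtain ⟨l, hl⟩ := huv
  obtain ⟨A, hA⟩ : ∃ A, (u - i) * j + v * i = r * A :=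
    ⟨l * j + v * k, by linear_combination j * hl + v * hk⟩
  obtain ⟨B, hB⟩ : ∃ B, (u - i) * j' + v * i' = r * (1 - B) :=
    ⟨1 - (l * j' + v * k'), by linear_combination j' * hl + v * hk'⟩
  have e1 : u = A * i' + B * i := by
    apply mul_left_cancel₀ hr.ne'
    linear_combination (-(u - i)) * hdet + i' * hA - i * hB
  have e2 : j - v = A * j' + B * j := by
    apply mul_left_cancel₀ hr.ne'
    linear_combination v * hdet + j' * hA - j * hB
  rcases lt_trichotomy A 0 with hA0 | rfl | hA0
  · have hBA : -A < B := by
      by_contra! h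
      nlinarith
    nlinarith
  · have h1 : B < 1 := by by_contra! h; nlinarith
    have h2 : 0 < B := by by_contra! h; nlinarith
    omega
  · have hB0 : B < 0 := by
      by_contra! h
      nlinarith
    have hBA : -B < A := by
      by_contra! h
      nlinarith
    nlinarith

lemma diagonal_map_monomial (a : ℕ) (ε : ℂ)
    (g : MvPolynomial (Fin 2) ℂ ≃ₐ[ℂ] MvPolynomial (Fin 2) ℂ)
    (hgx : g (X 0) = C ε * X 0) (hgy : g (X 1) = C (ε ^ a) * X 1) (m : Fin 2 →₀ ℕ) (c : ℂ) :
    g (monomial m c) = monomial m (ε ^ (m 0 + a * m 1) * c) := by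
  have hC (b : ℂ) : g (C b) = C b := g.commutes b
  rw [monomial_eq, monomial_eq, Finsupp.prod_fintype _ _ (by simp), map_mul, hC]
  simp only [Fin.prod_univ_two, map_mul, map_pow, hgx, hgy]
  ring

lemma diagonal_coeff_map (a : ℕ) (ε : ℂ)
    (g : MvPolynomial (Fin 2) ℂ ≃ₐ[ℂ] MvPolynomial (Fin 2) ℂ)
    (hgx : g (X 0) = C ε * X 0) (hgy : g (X 1) = C (ε ^ a) * X 1) (m : Fin 2 →₀ ℕ)
    (f : MvPolynomial (Fin 2) ℂ) :
    coeff m (g f) = ε ^ (m 0 + a * m 1) * coeff m f := by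
  induction f using MvPolynomial.induction_on' with
  | monomial u c =>
    rw [diagonal_map_monomial a ε g hgx hgy, coeff_monomial, coeff_monomial]
    split_ifs with h
    · rw [h]
    · simp
  | add p q hp hq => rw [map_add, coeff_add, hp, hq, coeff_add, mul_add]

lemma diagonal_map_monomial_of_dvd (r a : ℕ) (ε : ℂ) (hε : IsPrimitiveRoot ε r)
    (g : MvPolynomial (Fin 2) ℂ ≃ₐ[ℂ] MvPolynomial (Fin 2) ℂ)
    (hgx : g (X 0) = C ε * X 0) (hgy : g (X 1) = C (ε ^ a) * X 1) (m : Fin 2 →₀ ℕ) (c : ℂ)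
    (h : (r : ℤ) ∣ m 0 + a * m 1) : g (monomial m c) = monomial m c := by
  rw [diagonal_map_monomial a ε g hgx hgy,
    (hε.pow_eq_one_iff_dvd _).2 (by exact_mod_cast h), one_mul]

lemma monomial_eq_mul_X_pow (m : Fin 2 →₀ ℕ) (c : ℂ) (s : Fin 2) (k : ℕ) (h : k ≤ m s) :
    monomial m c = monomial (m - Finsupp.single s k) c * X s ^ k := by
  rw [X_pow_eq_monomial, monomial_mul, mul_one, tsub_add_cancel_of_le]
  exact Finsupp.single_le_iff.2 h

/-- for `1 ≤ p ≤ n`, the `R`-module `S_{i_p}` is generated by `x^{i_p}`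
and `y^{j_p}`: every `f` with `g f = ε^{i_p} f` can be written
`f = r₁ x^{i_p} + r₂ y^{j_p}` with `r₁, r₂` invariant. -/
theorem stmt_4 (r a n : ℕ) (α : ℕ → ℕ)
    (ha : 1 ≤ a) (har : a < r) (hcop : Nat.Coprime r a) (hn : 1 ≤ n)
    (hα : ∀ t, 1 ≤ t → t ≤ n → 2 ≤ α t)
    (hval : hj ((List.range n).map fun t => (α (t + 1) : ℚ)) = (r : ℚ) / (a : ℚ))
    (ε : ℂ) (hε : IsPrimitiveRoot ε r)
    (g : MvPolynomial (Fin 2) ℂ ≃ₐ[ℂ] MvPolynomial (Fin 2) ℂ)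
    (hgx : g (X 0) = C ε * X 0) (hgy : g (X 1) = C (ε ^ a) * X 1) :
    ∀ p, 1 ≤ p → p ≤ n → ∀ f : MvPolynomial (Fin 2) ℂ,
      g f = C (ε ^ ser r a α p) * f →
      ∃ r₁ r₂ : MvPolynomial (Fin 2) ℂ, g r₁ = r₁ ∧ g r₂ = r₂ ∧
        f = r₁ * X 0 ^ (ser r a α p).toNat + r₂ * X 1 ^ (ser 0 1 α p).toNat := by
  intro p hp hpn f hf
  obtain ⟨p, rfl⟩ : ∃ k, p = k + 1 := ⟨p - 1, by omega⟩
  obtain ⟨hi, hii⟩ := ser_pos_and_decreasing n r a α (by exact_mod_cast ha) hα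
    (by push_cast; exact hval) p (by omega)
  obtain ⟨hj0, hjj⟩ := ser_nonneg_and_increasing n α hα p (by omega)
  have hdet := ser_det r a α p
  have hd := dvd_ser_sub r a α (p + 1)
  have hd' := dvd_ser_sub r a α p
  set i := ser r a α (p + 1)
  set j := ser 0 1 α (p + 1)
  rw [f.as_sum]
  refine Finset.sum_induction _ (fun q => ∃ r₁ r₂ : MvPolynomial (Fin 2) ℂ, g r₁ = r₁ ∧
    g r₂ = r₂ ∧ q = r₁ * X 0 ^ i.toNat + r₂ * X 1 ^ j.toNat) ?_ ⟨0, 0, by simp⟩ ?_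
  · rintro _ _ ⟨r₁, r₂, h1, h2, rfl⟩ ⟨s₁, s₂, h3, h4, rfl⟩
    exact ⟨r₁ + s₁, r₂ + s₂, by rw [map_add, h1, h3], by rw [map_add, h2, h4], by ring⟩
  · intro m hm
    have hε0 : ε ≠ 0 := hε.ne_zero (by omega)
    have hpow : ε ^ (m 0 + a * m 1) = ε ^ i := by
      have h := congrArg (coeff m) hf
      rw [diagonal_coeff_map a ε g hgx hgy, coeff_C_mul] at h
      exact mul_right_cancel₀ (mem_support_iff.1 hm) h
    have hdvd : (r : ℤ) ∣ m 0 + a * m 1 - i := by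
      rw [← hε.zpow_eq_one_iff_dvd, zpow_sub₀ hε0, ← hpow, div_eq_one_iff_eq (pow_ne_zero _ hε0)]
      exact_mod_cast zpow_natCast ε (m 0 + a * m 1)
    rcases le_or_le_of_dvd (by omega) hi hii hjj hdet hd hd' (Int.natCast_nonneg _)
      (Int.natCast_nonneg _) hdvd with h | h
    · refine ⟨monomial (m - Finsupp.single 0 i.toNat) (coeff m f), 0, ?_, map_zero g, ?_⟩
      · apply diagonal_map_monomial_of_dvd r a ε hε g hgx hgy
        have h0 : (((m - Finsupp.single 0 i.toNat : Fin 2 →₀ ℕ) 0 : ℕ) : ℤ) = m 0 - i := by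
          simp only [Finsupp.tsub_apply, Finsupp.single_eq_same]
          omega
        have h1 : (m - Finsupp.single 0 i.toNat : Fin 2 →₀ ℕ) 1 = m 1 := by simp
        rw [h0, h1]
        convert hdvd using 1
        ring
      · rw [zero_mul, add_zero]
        exact monomial_eq_mul_X_pow m _ 0 _ (by omega)
    · refine ⟨0, monomial (m - Finsupp.single 1 j.toNat) (coeff m f), map_zero g, ?_, ?_⟩
      · apply diagonal_map_monomial_of_dvd r a ε hε g hgx hgy
        have h0 : (((m - Finsupp.single 1 j.toNat : Fin 2 →₀ ℕ) 1 : ℕ) : ℤ) = m 1 - j := by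
          simp only [Finsupp.tsub_apply, Finsupp.single_eq_same]
          omega
        have h1 : (m - Finsupp.single 1 j.toNat : Fin 2 →₀ ℕ) 0 = m 0 := by simp
        rw [h0, h1]
        rw [show (m 0 : ℤ) + a * (m 1 - j) = m 0 + a * m 1 - i + (i - a * j) by ring]
        exact dvd_add hdvd hd
      · rw [zero_mul, zero_add]
        exact monomial_eq_mul_X_pow m _ 1 _ (by omega)
end
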